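/- arXiv:math/0307145 — 5 statements merged into one kernel-verified Lean document; each statement's English description precedes it below -/
import Mathlib

section
/- Let P=(A,C) be a measuring α-pairing (A not necessarily unital) and M an A-faithful left A-module. Then: (i) the rational submodule Rat^C(M) is an A-submodule of M; (ii) for every A-submodule N ⊆ M one has Rat^C(N) = N ∩ Rat^C(M) (so in particular Rat^C(Rat^C(M)) = Rat^C(M)); (iii) for every A-faithful left A-module L and every A-linear map f: M → L one has f(Rat^C(M)) ⊆ Rat^C(L). -/
open TensorProduct

universe u

/-- The canonical map `α^P_M : M ⊗ C → Hom(A, M)` associated to an `R`-pairing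
`β : A → C → R`, sending `Σ mᵢ ⊗ cᵢ` to `a ↦ Σ ⟨a, cᵢ⟩ • mᵢ`. -/
noncomputable def alphaMap (R : Type u) [CommRing R]
    {A : Type u} [AddCommGroup A] [Module R A]
    {C : Type u} [AddCommGroup C] [Module R C]
    (β : A →ₗ[R] C →ₗ[R] R)
    (M : Type u) [AddCommGroup M] [Module R M] :
    (M ⊗[R] C) →ₗ[R] (A →ₗ[R] M) :=
  (dualTensorHom R A M) ∘ₗ
    (TensorProduct.comm R M (Module.Dual R A)).toLinearMap ∘ₗ
    (TensorProduct.map LinearMap.id β.flip)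

/-- `(A, C)` is a measuring pairing: `κ_P : A → C*` is multiplicative into the
convolution algebra `C*`. -/
def IsMeasuring (R : Type u) [CommRing R]
    {A : Type u} [NonUnitalRing A] [Module R A]
    {C : Type u} [AddCommGroup C] [Module R C] [Coalgebra R C]
    (β : A →ₗ[R] C →ₗ[R] R) : Prop :=
  ∀ a b : A,
    β (a * b) =
      (LinearMap.mul' R R) ∘ₗ (TensorProduct.map (β a) (β b)) ∘ₗ
        (Coalgebra.comul (R := R) (A := C))

/-- The rational submodule `Rat^C(M)` of a module with `A`-action `σ`. -/
noncomputable def ratSubmodule (R : Type u) [CommRing R]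
    {A : Type u} [AddCommGroup A] [Module R A]
    {C : Type u} [AddCommGroup C] [Module R C]
    (β : A →ₗ[R] C →ₗ[R] R)
    {M : Type u} [AddCommGroup M] [Module R M]
    (σ : A →ₗ[R] M →ₗ[R] M) : Submodule R M :=
  (LinearMap.range (alphaMap R β M)).comap σ.flip

/-- The `A`-action induced on a right `C`-comodule: `a • m = Σ m₍₀₎⟨a, m₍₁₎⟩`. -/
noncomputable def inducedAction (R : Type u) [CommRing R]
    {A : Type u} [AddCommGroup A] [Module R A]
    {C : Type u} [AddCommGroup C] [Module R C]
    (β : A →ₗ[R] C →ₗ[R] R)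
    {M : Type u} [AddCommGroup M] [Module R M]
    (ϱ : M →ₗ[R] M ⊗[R] C) : A →ₗ[R] M →ₗ[R] M :=
  ((alphaMap R β M) ∘ₗ ϱ).flip

/-- `ϱ : M → M ⊗ C` is a (coassociative, counital) right `C`-comodule structure. -/
def IsRightComodule (R : Type u) [CommRing R]
    {C : Type u} [AddCommGroup C] [Module R C] [Coalgebra R C]
    {M : Type u} [AddCommGroup M] [Module R M]
    (ϱ : M →ₗ[R] M ⊗[R] C) : Prop :=
  ((TensorProduct.assoc R M C C).toLinearMap ∘ₗ (TensorProduct.map ϱ LinearMap.id) ∘ₗ ϱ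
      = (TensorProduct.map LinearMap.id (Coalgebra.comul (R := R))) ∘ₗ ϱ)
  ∧ ∀ m : M,
      (TensorProduct.rid R M)
        ((TensorProduct.map LinearMap.id (Coalgebra.counit (R := R))) (ϱ m)) = m

/-- `ϱ : N → C ⊗ N` is a (coassociative, counital) left `C`-comodule structure. -/
def IsLeftComodule (R : Type u) [CommRing R]
    {C : Type u} [AddCommGroup C] [Module R C] [Coalgebra R C]
    {N : Type u} [AddCommGroup N] [Module R N]
    (ϱ : N →ₗ[R] C ⊗[R] N) : Prop :=
  ((TensorProduct.assoc R C C N).symm.toLinearMap ∘ₗ (TensorProduct.map LinearMap.id ϱ) ∘ₗ ϱ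
      = (TensorProduct.map (Coalgebra.comul (R := R)) LinearMap.id) ∘ₗ ϱ)
  ∧ ∀ n : N,
      (TensorProduct.lid R N)
        ((TensorProduct.map (Coalgebra.counit (R := R)) LinearMap.id) (ϱ n)) = n

/-- The cotensor product `M □_C N` as a submodule of `M ⊗ N`. -/
noncomputable def cotensor (R : Type u) [CommRing R]
    {C : Type u} [AddCommGroup C] [Module R C]
    {M : Type u} [AddCommGroup M] [Module R M]
    {N : Type u} [AddCommGroup N] [Module R N]
    (ϱM : M →ₗ[R] M ⊗[R] C) (ϱN : N →ₗ[R] C ⊗[R] N) : Submodule R (M ⊗[R] N) :=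
  LinearMap.ker
    ((TensorProduct.assoc R M C N).toLinearMap ∘ₗ (TensorProduct.map ϱM LinearMap.id)
      - (TensorProduct.map LinearMap.id ϱN))

/-- The right `A`-action induced on a left `C`-comodule: `n • a = Σ ⟨a, n₍₋₁₎⟩ n₍₀₎`. -/
noncomputable def rAct (R : Type u) [CommRing R]
    {A : Type u} [AddCommGroup A] [Module R A]
    {C : Type u} [AddCommGroup C] [Module R C]
    {N : Type u} [AddCommGroup N] [Module R N]
    (β : A →ₗ[R] C →ₗ[R] R) (ϱ : N →ₗ[R] C ⊗[R] N) (a : A) : N →ₗ[R] N :=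
  (TensorProduct.lid R N).toLinearMap ∘ₗ (TensorProduct.map (β a) LinearMap.id) ∘ₗ ϱ

/-- `Hom_{A-}(B, N)`: the `A`-linear maps `B → N`, where `B` is an `A`-module via `ξ`. -/
noncomputable def homA (R : Type u) [CommRing R]
    {A B N : Type u} [Ring A] [Algebra R A] [Ring B] [Algebra R B]
    [AddCommGroup N] [Module R N]
    (ξ : A →ₐ[R] B) (σN : A →ₗ[R] N →ₗ[R] N) : Submodule R (B →ₗ[R] N) where
  carrier := {f | ∀ (a : A) (b : B), f (ξ a * b) = σN a (f b)}
  zero_mem' := by intro a b; simp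
  add_mem' := by intro f g hf hg a b; simp [hf a b, hg a b]
  smul_mem' := by intro r f hf a b; simp [hf a b]

/-- Evaluation at `1_B` as a linear map on a submodule of `Hom_R(B, N)`. -/
noncomputable def evalAtOne {R B N : Type u} [CommRing R] [Ring B] [Algebra R B]
    [AddCommGroup N] [Module R N] (Hsub : Submodule R (B →ₗ[R] N)) : ↥Hsub →ₗ[R] N where
  toFun f := (f : B →ₗ[R] N) 1
  map_add' f g := by simp
  map_smul' r f := by simp

@[simp]
theorem alphaMap_tmul_apply {R A C M : Type u} [CommRing R]
    [AddCommGroup A] [Module R A] [AddCommGroup C] [Module R C] [AddCommGroup M] [Module R M]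
    (β : A →ₗ[R] C →ₗ[R] R) (m : M) (c : C) (a : A) :
    alphaMap R β M (m ⊗ₜ c) a = β a c • m := by
  simp [alphaMap]

/-- Naturality of `alphaMap` in the module. -/
theorem alphaMap_rTensor {R A C M L : Type u} [CommRing R]
    [AddCommGroup A] [Module R A] [AddCommGroup C] [Module R C]
    [AddCommGroup M] [Module R M] [AddCommGroup L] [Module R L]
    (β : A →ₗ[R] C →ₗ[R] R) (f : M →ₗ[R] L) (t : M ⊗[R] C) :
    alphaMap R β L (f.rTensor C t) = f ∘ₗ alphaMap R β M t := by
  induction t with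
  | zero => simp
  | add x y hx hy => simp [hx, hy, LinearMap.comp_add]
  | tmul m c => ext a; simp

theorem mem_ratSubmodule_iff {R A C M : Type u} [CommRing R]
    [AddCommGroup A] [Module R A] [AddCommGroup C] [Module R C] [AddCommGroup M] [Module R M]
    {β : A →ₗ[R] C →ₗ[R] R} {σ : A →ₗ[R] M →ₗ[R] M} {m : M} :
    m ∈ ratSubmodule R β σ ↔ ∃ t : M ⊗[R] C, alphaMap R β M t = σ.flip m :=
  Iff.rfl

/-- The operator `c ↦ Σ ⟨a, c₍₂₎⟩ c₍₁₎` on `C` is adjoint to right multiplication by `a`. -/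
theorem IsMeasuring.apply_mul {R A C : Type u} [CommRing R]
    [NonUnitalRing A] [Module R A] [AddCommGroup C] [Module R C] [Coalgebra R C]
    {β : A →ₗ[R] C →ₗ[R] R} (hmeas : IsMeasuring R β) (b a : A) (c : C) :
    β b (TensorProduct.rid R C ((β a).lTensor C (Coalgebra.comul (R := R) c))) =
      β (b * a) c := by
  rw [hmeas b a]
  simp only [LinearMap.comp_apply]
  induction Coalgebra.comul (R := R) c with
  | zero => simp
  | add x y hx hy => simp only [map_add, hx, hy]
  | tmul x y => simp [mul_comm]

/-- Translating a tensor by `a` on the coalgebra side translates its image under `alphaMap`. -/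
theorem IsMeasuring.alphaMap_lTensor {R A C M : Type u} [CommRing R]
    [NonUnitalRing A] [Module R A] [AddCommGroup C] [Module R C] [Coalgebra R C]
    [AddCommGroup M] [Module R M]
    {β : A →ₗ[R] C →ₗ[R] R} (hmeas : IsMeasuring R β) (b a : A) (t : M ⊗[R] C) :
    alphaMap R β M
        (((TensorProduct.rid R C).toLinearMap ∘ₗ (β a).lTensor C ∘ₗ
          Coalgebra.comul (R := R)).lTensor M t) b =
      alphaMap R β M t (b * a) := by
  induction t with
  | zero => simp
  | add x y hx hy => simp only [map_add, LinearMap.add_apply, hx, hy]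
  | tmul m c =>
    simp only [LinearMap.lTensor_tmul, alphaMap_tmul_apply, LinearMap.comp_apply,
      LinearEquiv.coe_coe, hmeas.apply_mul]

/-- Equivariant maps send rational elements to rational elements. -/
theorem map_mem_ratSubmodule {R A C M L : Type u} [CommRing R]
    [AddCommGroup A] [Module R A] [AddCommGroup C] [Module R C]
    [AddCommGroup M] [Module R M] [AddCommGroup L] [Module R L]
    {β : A →ₗ[R] C →ₗ[R] R} {σM : A →ₗ[R] M →ₗ[R] M} {σL : A →ₗ[R] L →ₗ[R] L}
    (f : M →ₗ[R] L) (hf : ∀ (a : A) (m : M), f (σM a m) = σL a (f m))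
    {m : M} (hm : m ∈ ratSubmodule R β σM) : f m ∈ ratSubmodule R β σL := by
  obtain ⟨t, ht⟩ := mem_ratSubmodule_iff.1 hm
  refine mem_ratSubmodule_iff.2 ⟨f.rTensor C t, ?_⟩
  ext a
  simp [alphaMap_rTensor, ht, hf]

/-- If the `α`-condition holds, an element of a submodule that is rational in the ambient module
is rational in the submodule. -/
theorem mem_ratSubmodule_of_coe_mem {R A C M : Type u} [CommRing R]
    [AddCommGroup A] [Module R A] [AddCommGroup C] [Module R C] [AddCommGroup M] [Module R M]
    {β : A →ₗ[R] C →ₗ[R] R} {σM : A →ₗ[R] M →ₗ[R] M} {N : Submodule R M}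
    (hα : ∀ (X : Type u) [AddCommGroup X] [Module R X], Function.Injective (alphaMap R β X))
    {σN : A →ₗ[R] N →ₗ[R] N} (hσN : ∀ (a : A) (n : N), ((σN a n : N) : M) = σM a (n : M))
    {n : N} (hn : (n : M) ∈ ratSubmodule R β σM) : n ∈ ratSubmodule R β σN := by
  obtain ⟨t, ht⟩ := mem_ratSubmodule_iff.1 hn
  have hzero : N.mkQ.rTensor C t = 0 := by
    apply hα (M ⧸ N)
    rw [alphaMap_rTensor, ht, map_zero]
    ext a
    simp [← hσN]
  obtain ⟨s, rfl⟩ := (rTensor_exact C (LinearMap.exact_subtype_mkQ N) N.mkQ_surjective t).1 hzero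
  refine mem_ratSubmodule_iff.2 ⟨s, ?_⟩
  rw [alphaMap_rTensor] at ht
  ext a
  simpa [hσN] using LinearMap.congr_fun ht a

/-- Let `P = (A,C)` be a measuring α-pairing (`A` not necessarily unital)
and `M` an `A`-faithful left `A`-module. Then (i) `Rat^C(M)` is an `A`-submodule of `M`;
(ii) for every `A`-submodule `N ⊆ M` (with the restricted `A`-action `σN`),
`Rat^C(N) = N ∩ Rat^C(M)`; (iii) for every `A`-faithful left `A`-module `L` and `A`-linear
`f : M → L`, `f(Rat^C(M)) ⊆ Rat^C(L)`. -/
theorem rat_submodule_properties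
    {R A C M L : Type u} [CommRing R]
    [NonUnitalRing A] [Module R A] [SMulCommClass R A A] [IsScalarTower R A A]
    [AddCommGroup C] [Module R C] [Coalgebra R C]
    [AddCommGroup M] [Module R M] [AddCommGroup L] [Module R L]
    (β : A →ₗ[R] C →ₗ[R] R)
    (hmeas : IsMeasuring R β)
    (hα : ∀ (X : Type u) [AddCommGroup X] [Module R X],
      Function.Injective (alphaMap R β X))
    (σM : A →ₗ[R] M →ₗ[R] M)
    (hσM : ∀ a b : A, σM (a * b) = (σM a) ∘ₗ (σM b))
    (hMfaithful : Function.Injective σM.flip)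
    (σL : A →ₗ[R] L →ₗ[R] L)
    (hσL : ∀ a b : A, σL (a * b) = (σL a) ∘ₗ (σL b))
    (hLfaithful : Function.Injective σL.flip) :
    -- (i)
    (∀ a : A, ∀ m ∈ ratSubmodule R β σM, σM a m ∈ ratSubmodule R β σM)
    ∧
    -- (ii)
    (∀ N : Submodule R M, (∀ a : A, ∀ m ∈ N, σM a m ∈ N) →
      ∀ σN : A →ₗ[R] N →ₗ[R] N,
        (∀ (a : A) (n : N), ((σN a n : N) : M) = σM a (n : M)) →
        ∀ n : N, n ∈ ratSubmodule R β σN ↔ (n : M) ∈ ratSubmodule R β σM)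
    ∧
    -- (iii)
    (∀ f : M →ₗ[R] L, (∀ (a : A) (m : M), f (σM a m) = σL a (f m)) →
      ∀ m ∈ ratSubmodule R β σM, f m ∈ ratSubmodule R β σL) := by
  refine ⟨fun a m hm => ?_, fun N _ σN hσN n => ?_, fun f hf m hm => map_mem_ratSubmodule f hf hm⟩
  · obtain ⟨t, ht⟩ := mem_ratSubmodule_iff.1 hm
    refine mem_ratSubmodule_iff.2 ⟨_, LinearMap.ext fun b =>
      (hmeas.alphaMap_lTensor b a t).trans ?_⟩
    simp [ht, hσM]
  · exact ⟨map_mem_ratSubmodule N.subtype hσN, mem_ratSubmodule_of_coe_mem hα hσN⟩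
end

section
/- Let P=(A,C) be a measuring α-pairing (A not necessarily unital). If (M,ρ_M) is an A-faithful left A-module which is C-rational (i.e. ρ_M(M) ⊆ α_M^P(M⊗_R C)), then ϱ_M := (α_M^P)^{-1}∘ρ_M : M → M⊗_R C is a coassociative, counital right C-comodule structure on M, and ϱ_M is injective, i.e. (M,ϱ_M) is a counital right C-comodule. -/
open TensorProduct

universe u

/-- Contraction of the right tensor factor by a functional: `m ⊗ c ↦ f c • m`. -/
noncomputable def sliceRight {R C : Type*} [CommRing R] [AddCommGroup C] [Module R C]
    (M : Type*) [AddCommGroup M] [Module R M] (f : C →ₗ[R] R) : M ⊗[R] C →ₗ[R] M :=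
  (TensorProduct.rid R M).toLinearMap ∘ₗ TensorProduct.map LinearMap.id f

@[simp]
theorem sliceRight_tmul {R C M : Type*} [CommRing R] [AddCommGroup C] [Module R C]
    [AddCommGroup M] [Module R M] (f : C →ₗ[R] R) (m : M) (c : C) :
    sliceRight M f (m ⊗ₜ[R] c) = f c • m := by
  simp [sliceRight]

theorem sliceRight_map_left {R C M N : Type*} [CommRing R] [AddCommGroup C] [Module R C]
    [AddCommGroup M] [Module R M] [AddCommGroup N] [Module R N]
    (f : C →ₗ[R] R) (φ : M →ₗ[R] N) (t : M ⊗[R] C) :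
    sliceRight N f (TensorProduct.map φ LinearMap.id t) = φ (sliceRight M f t) := by
  induction t with
  | zero => simp
  | tmul m c => simp
  | add x y hx hy => simp only [map_add, hx, hy]

theorem sliceRight_map_right {R C D M : Type*} [CommRing R] [AddCommGroup C] [Module R C]
    [AddCommGroup D] [Module R D] [AddCommGroup M] [Module R M]
    (f : D →ₗ[R] R) (g : C →ₗ[R] D) (t : M ⊗[R] C) :
    sliceRight M f (TensorProduct.map LinearMap.id g t) = sliceRight M (f ∘ₗ g) t := by
  induction t with
  | zero => simp
  | tmul m c => simp
  | add x y hx hy => simp only [map_add, hx, hy]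

/-- Contracting successively by `g` and `f` is contracting by `f ⊗ g`. -/
theorem sliceRight_assoc {R C D M : Type*} [CommRing R] [AddCommGroup C] [Module R C]
    [AddCommGroup D] [Module R D] [AddCommGroup M] [Module R M]
    (f : C →ₗ[R] R) (g : D →ₗ[R] R) (t : (M ⊗[R] C) ⊗[R] D) :
    sliceRight M (LinearMap.mul' R R ∘ₗ TensorProduct.map f g) (TensorProduct.assoc R M C D t)
      = sliceRight M f (sliceRight (M ⊗[R] C) g t) := by
  induction t with
  | zero => simp
  | add x y hx hy => simp only [map_add, hx, hy]
  | tmul x d =>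
    induction x with
    | zero => simp
    | add x y hx hy => simp only [TensorProduct.add_tmul, map_add, hx, hy]
    | tmul m c => simp [smul_smul, mul_comm]

theorem alphaMap_apply {R A C M : Type u} [CommRing R] [AddCommGroup A] [Module R A]
    [AddCommGroup C] [Module R C] [AddCommGroup M] [Module R M]
    (β : A →ₗ[R] C →ₗ[R] R) (t : M ⊗[R] C) (a : A) :
    alphaMap R β M t a = sliceRight M (β a) t := by
  induction t with
  | zero => simp
  | tmul m c => simp [alphaMap]
  | add x y hx hy => simp only [map_add, LinearMap.add_apply, hx, hy]

/-- Under the `α`-condition, elements of `M ⊗ (C ⊗ C)` are separated by the functionals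
`⟨a, -⟩ ⊗ ⟨b, -⟩`. -/
theorem eq_of_sliceRight_eq {R A C M : Type u} [CommRing R] [AddCommGroup A] [Module R A]
    [AddCommGroup C] [Module R C] [AddCommGroup M] [Module R M]
    {β : A →ₗ[R] C →ₗ[R] R}
    (hα : ∀ (X : Type u) [AddCommGroup X] [Module R X], Function.Injective (alphaMap R β X))
    {s t : M ⊗[R] (C ⊗[R] C)}
    (h : ∀ a b, sliceRight M (LinearMap.mul' R R ∘ₗ TensorProduct.map (β a) (β b)) s
      = sliceRight M (LinearMap.mul' R R ∘ₗ TensorProduct.map (β a) (β b)) t) : s = t := by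
  obtain ⟨s, rfl⟩ := (TensorProduct.assoc R M C C).surjective s
  obtain ⟨t, rfl⟩ := (TensorProduct.assoc R M C C).surjective t
  congr 1
  refine hα _ (LinearMap.ext fun b => hα _ (LinearMap.ext fun a => ?_))
  simpa only [alphaMap_apply, sliceRight_assoc] using h a b

/-- A coassociative `ϱ` turns the convolution product of functionals into the composition of the
induced operators `sliceRight M f ∘ ϱ`. -/
theorem sliceRight_convolution {R C M : Type*} [CommRing R]
    [AddCommGroup C] [Module R C] [Coalgebra R C] [AddCommGroup M] [Module R M]
    {ϱ : M →ₗ[R] M ⊗[R] C}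
    (hϱ : (TensorProduct.assoc R M C C).toLinearMap ∘ₗ TensorProduct.map ϱ LinearMap.id ∘ₗ ϱ
      = TensorProduct.map LinearMap.id (Coalgebra.comul (R := R)) ∘ₗ ϱ)
    (f g : C →ₗ[R] R) (m : M) :
    sliceRight M (LinearMap.mul' R R ∘ₗ TensorProduct.map f g ∘ₗ Coalgebra.comul) (ϱ m)
      = sliceRight M f (ϱ (sliceRight M g (ϱ m))) := by
  have h := congrArg (sliceRight M (LinearMap.mul' R R ∘ₗ TensorProduct.map f g))
    (LinearMap.congr_fun hϱ m)
  simpa only [LinearMap.comp_apply, LinearEquiv.coe_coe, sliceRight_assoc,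
    sliceRight_map_left, sliceRight_map_right, LinearMap.comp_assoc] using h.symm

theorem convolution_counit {R C : Type*} [CommRing R] [AddCommGroup C] [Module R C]
    [Coalgebra R C] (f : C →ₗ[R] R) :
    LinearMap.mul' R R ∘ₗ TensorProduct.map f Coalgebra.counit ∘ₗ Coalgebra.comul = f := by
  ext c
  have h := congrArg (LinearMap.mul' R R ∘ₗ TensorProduct.map f LinearMap.id)
    (Coalgebra.lTensor_counit_comul (R := R) c)
  rw [LinearMap.comp_apply, LinearMap.lTensor, ← LinearMap.comp_apply (TensorProduct.map f _),
    ← TensorProduct.map_comp] at h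
  simpa using h

/-- For a measuring α-pairing `P = (A,C)` (`A` not necessarily unital),
every `A`-faithful `C`-rational left `A`-module `(M, σ)` carries a right `C`-comodule
structure `ϱ := (α_M^P)⁻¹ ∘ ρ_M`, i.e. `α_M^P ∘ ϱ = ρ_M`, which is coassociative,
counital and injective (a counital right `C`-comodule). -/
theorem rational_module_is_comodule
    {R A C M : Type u} [CommRing R]
    [NonUnitalRing A] [Module R A] [SMulCommClass R A A] [IsScalarTower R A A]
    [AddCommGroup C] [Module R C] [Coalgebra R C]
    [AddCommGroup M] [Module R M]
    (β : A →ₗ[R] C →ₗ[R] R)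
    (hmeas : IsMeasuring R β)
    (hα : ∀ (X : Type u) [AddCommGroup X] [Module R X],
      Function.Injective (alphaMap R β X))
    (σ : A →ₗ[R] M →ₗ[R] M)
    (hσ : ∀ a b : A, σ (a * b) = (σ a) ∘ₗ (σ b))
    (hfaithful : Function.Injective σ.flip)
    (hrat : ∀ m : M, σ.flip m ∈ LinearMap.range (alphaMap R β M)) :
    ∃ ϱ : M →ₗ[R] M ⊗[R] C,
      ((alphaMap R β M) ∘ₗ ϱ = σ.flip)
      ∧ IsRightComodule R ϱ
      ∧ Function.Injective ϱ := by
  have hϱ : ∃ ϱ : M →ₗ[R] M ⊗[R] C, alphaMap R β M ∘ₗ ϱ = σ.flip := by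
    refine ⟨(LinearEquiv.ofInjective _ (hα M)).symm.toLinearMap ∘ₗ σ.flip.codRestrict _ hrat, ?_⟩
    ext1 m
    exact congrArg Subtype.val
      ((LinearEquiv.ofInjective _ (hα M)).apply_symm_apply (σ.flip.codRestrict _ hrat m))
  obtain ⟨ϱ, hϱ⟩ := hϱ
  have hact (a : A) (m : M) : sliceRight M (β a) (ϱ m) = σ a m := by
    rw [← alphaMap_apply, ← LinearMap.comp_apply, hϱ, LinearMap.flip_apply]
  have hcoassoc : (TensorProduct.assoc R M C C).toLinearMap ∘ₗ TensorProduct.map ϱ LinearMap.id ∘ₗ ϱ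
      = TensorProduct.map LinearMap.id (Coalgebra.comul (R := R)) ∘ₗ ϱ := by
    ext1 m
    refine eq_of_sliceRight_eq hα fun a b => ?_
    simp only [LinearMap.comp_apply, LinearEquiv.coe_coe, sliceRight_assoc,
      sliceRight_map_left, sliceRight_map_right, hact]
    rw [LinearMap.comp_assoc, ← hmeas, hact, hσ, LinearMap.comp_apply]
  have hcounit (m : M) : sliceRight M (Coalgebra.counit (R := R)) (ϱ m) = m := by
    refine hfaithful (LinearMap.ext fun a => ?_)
    rw [LinearMap.flip_apply, LinearMap.flip_apply, ← hact, ← sliceRight_convolution hcoassoc,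
      convolution_counit, hact]
  exact ⟨ϱ, hϱ, ⟨hcoassoc, hcounit⟩, Function.LeftInverse.injective hcounit⟩
end

section
/- Let P=(A,C) be a measuring α-pairing and let M, N be C-rational A-faithful left A-modules, equipped with the induced right C-comodule structures ϱ_M = (α_M^P)^{-1}∘ρ_M and ϱ_N = (α_N^P)^{-1}∘ρ_N. Then an R-linear map f: M → N is C-colinear if and only if it is A-linear; that is, Hom^C(M,N) = Hom_{A}(M,N). -/
open TensorProduct

universe u

/-- Naturality of `α^P` in the module argument. -/
theorem alphaMap_map {R : Type u} [CommRing R]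
    {A : Type u} [AddCommGroup A] [Module R A]
    {C : Type u} [AddCommGroup C] [Module R C]
    (β : A →ₗ[R] C →ₗ[R] R)
    {M N : Type u} [AddCommGroup M] [Module R M] [AddCommGroup N] [Module R N]
    (f : M →ₗ[R] N) (x : M ⊗[R] C) :
    alphaMap R β N (TensorProduct.map f LinearMap.id x) = f ∘ₗ alphaMap R β M x := by
  induction x with
  | zero => simp
  | add x y hx hy => simp [hx, hy, LinearMap.comp_add]
  | tmul m c => ext a; simp [alphaMap]

/-- For a measuring α-pairing `P = (A,C)` and `C`-rational `A`-faithful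
left `A`-modules `M`, `N` with the induced coactions `ϱM`, `ϱN` (characterized by
`α^P ∘ ϱ = ρ`), an `R`-linear map `f : M → N` is `C`-colinear iff it is `A`-linear:
`Hom^C(M,N) = Hom_A(M,N)`. -/
theorem homC_eq_homA
    {R A C M N : Type u} [CommRing R]
    [NonUnitalRing A] [Module R A] [SMulCommClass R A A] [IsScalarTower R A A]
    [AddCommGroup C] [Module R C] [Coalgebra R C]
    [AddCommGroup M] [Module R M] [AddCommGroup N] [Module R N]
    (β : A →ₗ[R] C →ₗ[R] R)
    (hmeas : IsMeasuring R β)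
    (hα : ∀ (X : Type u) [AddCommGroup X] [Module R X],
      Function.Injective (alphaMap R β X))
    (σM : A →ₗ[R] M →ₗ[R] M)
    (hσM : ∀ a b : A, σM (a * b) = (σM a) ∘ₗ (σM b))
    (hMfaithful : Function.Injective σM.flip)
    (ϱM : M →ₗ[R] M ⊗[R] C) (hϱM : (alphaMap R β M) ∘ₗ ϱM = σM.flip)
    (σN : A →ₗ[R] N →ₗ[R] N)
    (hσN : ∀ a b : A, σN (a * b) = (σN a) ∘ₗ (σN b))
    (hNfaithful : Function.Injective σN.flip)
    (ϱN : N →ₗ[R] N ⊗[R] C) (hϱN : (alphaMap R β N) ∘ₗ ϱN = σN.flip) :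
    ∀ f : M →ₗ[R] N,
      (ϱN ∘ₗ f = (TensorProduct.map f LinearMap.id) ∘ₗ ϱM)
      ↔ (∀ (a : A) (m : M), f (σM a m) = σN a (f m)) := by
  intro f
  have hM : ∀ m a, alphaMap R β M (ϱM m) a = σM a m := fun m a =>
    LinearMap.congr_fun (LinearMap.congr_fun hϱM m) a
  have hN : ∀ n a, alphaMap R β N (ϱN n) a = σN a n := fun n a =>
    LinearMap.congr_fun (LinearMap.congr_fun hϱN n) a
  constructor
  · intro h a m
    have hm : ϱN (f m) = TensorProduct.map f LinearMap.id (ϱM m) := LinearMap.congr_fun h m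
    rw [← hN, hm, alphaMap_map, LinearMap.comp_apply, hM]
  · intro h
    ext m
    apply hα N
    ext a
    simp only [LinearMap.comp_apply]
    rw [hN, alphaMap_map, LinearMap.comp_apply, hM, h]
end

section
/- Let P=(A,C) be a measuring R-pairing, M a right C-comodule and N a left C-comodule, with induced A-actions a·m = Σ m_{<0>}⟨a,m_{<1>}⟩ on M and n·a = Σ ⟨a,n_{<-1>}⟩n_{<0>} on N. If the map α_{M⊗N}^P: (M⊗_R N)⊗_R C → Hom_R(A, M⊗_R N) is injective, then an element Σ mᵢ⊗nᵢ ∈ M⊗_R N lies in the cotensor product M□_C N if and only if Σ a·mᵢ⊗nᵢ = Σ mᵢ⊗nᵢ·a for all a∈A. -/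
open TensorProduct

universe u

/-- The rearrangement `M ⊗ (C ⊗ N) ≃ (M ⊗ N) ⊗ C`, `m ⊗ (c ⊗ n) ↦ (m ⊗ n) ⊗ c`. -/
noncomputable def moveMiddleRight (R M C N : Type u) [CommRing R]
    [AddCommGroup C] [Module R C] [AddCommGroup M] [Module R M] [AddCommGroup N] [Module R N] :
    M ⊗[R] (C ⊗[R] N) ≃ₗ[R] (M ⊗[R] N) ⊗[R] C :=
  (TensorProduct.congr (LinearEquiv.refl R M) (TensorProduct.comm R C N)).trans
    (TensorProduct.assoc R M N C).symm

section

variable {R A C M N : Type u} [CommRing R] [AddCommGroup A] [Module R A]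
  [AddCommGroup C] [Module R C] [AddCommGroup M] [Module R M] [AddCommGroup N] [Module R N]
  (β : A →ₗ[R] C →ₗ[R] R)

theorem alphaMap_tmul (m : M) (c : C) (a : A) : alphaMap R β M (m ⊗ₜ c) a = β a c • m := by
  simp [alphaMap]

theorem alphaMap_moveMiddleRight_assoc (a : A) (y : M ⊗[R] C) (n : N) :
    alphaMap R β (M ⊗[R] N) (moveMiddleRight R M C N (TensorProduct.assoc R M C N (y ⊗ₜ n))) a
      = alphaMap R β M y a ⊗ₜ n := by
  induction y with
  | zero => simp
  | add y z hy hz => simp [TensorProduct.add_tmul, hy, hz]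
  | tmul m c => simp [moveMiddleRight, alphaMap_tmul, TensorProduct.smul_tmul']

theorem alphaMap_moveMiddleRight_tmul (a : A) (m : M) (y : C ⊗[R] N) :
    alphaMap R β (M ⊗[R] N) (moveMiddleRight R M C N (m ⊗ₜ y)) a
      = m ⊗ₜ TensorProduct.lid R N (TensorProduct.map (β a) LinearMap.id y) := by
  induction y with
  | zero => simp
  | add y z hy hz => simp [TensorProduct.tmul_add, hy, hz]
  | tmul c n => simp [moveMiddleRight, alphaMap_tmul]

/-- Pairing the right coaction of `M` with `a` gives the action of `a` on the left factor. -/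
theorem alphaMap_map_coaction_id (ϱM : M →ₗ[R] M ⊗[R] C) (a : A) (x : M ⊗[R] N) :
    alphaMap R β (M ⊗[R] N) (moveMiddleRight R M C N
        (TensorProduct.assoc R M C N (TensorProduct.map ϱM LinearMap.id x))) a
      = TensorProduct.map (inducedAction R β ϱM a) LinearMap.id x := by
  induction x with
  | zero => simp
  | add x y hx hy => simp [hx, hy]
  | tmul m n => simp [alphaMap_moveMiddleRight_assoc, inducedAction]

/-- Pairing the left coaction of `N` with `a` gives the action of `a` on the right factor. -/
theorem alphaMap_map_id_coaction (ϱN : N →ₗ[R] C ⊗[R] N) (a : A) (x : M ⊗[R] N) :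
    alphaMap R β (M ⊗[R] N) (moveMiddleRight R M C N (TensorProduct.map LinearMap.id ϱN x)) a
      = TensorProduct.map LinearMap.id (rAct R β ϱN a) x := by
  induction x with
  | zero => simp
  | add x y hx hy => simp [hx, hy]
  | tmul m n => simp [alphaMap_moveMiddleRight_tmul, rAct]

end

/-- Let `P = (A,C)` be a measuring pairing, `M` a right and `N` a left
`C`-comodule with the induced `A`-actions. If `α^P_{M⊗N}` is injective, then
`x ∈ M □_C N` iff `Σ a·mᵢ ⊗ nᵢ = Σ mᵢ ⊗ nᵢ·a` for all `a ∈ A`. -/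
theorem mem_cotensor_iff_balanced
    {R A C M N : Type u} [CommRing R]
    [NonUnitalRing A] [Module R A] [SMulCommClass R A A] [IsScalarTower R A A]
    [AddCommGroup C] [Module R C] [Coalgebra R C]
    [AddCommGroup M] [Module R M] [AddCommGroup N] [Module R N]
    (β : A →ₗ[R] C →ₗ[R] R)
    (hmeas : IsMeasuring R β)
    (ϱM : M →ₗ[R] M ⊗[R] C) (hM : IsRightComodule R ϱM)
    (ϱN : N →ₗ[R] C ⊗[R] N) (hN : IsLeftComodule R ϱN)
    (hα : Function.Injective (alphaMap R β (M ⊗[R] N))) :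
    ∀ x : M ⊗[R] N,
      x ∈ cotensor R ϱM ϱN
      ↔ ∀ a : A,
          TensorProduct.map (inducedAction R β ϱM a) LinearMap.id x
            = TensorProduct.map LinearMap.id (rAct R β ϱN a) x := by
  intro x
  rw [cotensor, LinearMap.mem_ker, LinearMap.sub_apply, sub_eq_zero,
    ← (moveMiddleRight R M C N).injective.eq_iff, ← hα.eq_iff, LinearMap.ext_iff]
  refine forall_congr' fun a => ?_
  rw [LinearMap.comp_apply, LinearEquiv.coe_coe, alphaMap_map_coaction_id,
    alphaMap_map_id_coaction]
end

section
/- Let C and D be R-coalgebras with D flat as an R-module, and let θ: D → C be an R-coalgebra morphism. For a right D-comodule N, let N^θ denote N regarded as a right C-comodule via (id_N⊗θ)∘ϱ_N; regard D as a left C-comodule via (θ⊗id_D)∘Δ_D, and for a right C-comodule L regard L□_C D as a right D-comodule via id_L□_C Δ_D. Then the map Φ_{N,L}: Hom^D(N, L□_C D) → Hom^C(N^θ, L), f ↦ (id_L□_C θ)∘f followed by the canonical isomorphism L□_C C ≅ L, is a bijection natural in N and L, with inverse g ↦ (g□_C id_D)∘ϱ_N; that is, the corestriction functor (−)^θ: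 M^D → M^C is left adjoint to the functor −□_C D: M^C → M^D. -/
open TensorProduct

universe u

/-- The map `Φ : Hom^D(N, L □_C D) → Hom^C(N^θ, L)`: compose with `id_L □_C θ` and the
canonical isomorphism `L □_C C ≅ L` (concretely `Σ lᵢ ⊗ dᵢ ↦ Σ ε_C(θ dᵢ) lᵢ`). -/
noncomputable def PhiMap {R C D L N : Type u} [CommRing R]
    [AddCommGroup C] [Module R C] [Coalgebra R C]
    [AddCommGroup D] [Module R D]
    [AddCommGroup L] [Module R L] [AddCommGroup N] [Module R N]
    (θ : D →ₗ[R] C) (f : N →ₗ[R] L ⊗[R] D) : N →ₗ[R] L :=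
  (TensorProduct.rid R L).toLinearMap ∘ₗ
    (TensorProduct.map LinearMap.id ((Coalgebra.counit (R := R) (A := C)) ∘ₗ θ)) ∘ₗ f

section CounitContraction

variable {R C D L N : Type u} [CommRing R]
  [AddCommGroup C] [Module R C] [AddCommGroup D] [Module R D]
  [AddCommGroup L] [Module R L] [AddCommGroup N] [Module R N]

lemma map_rid_assoc_symm_tmul (e : D →ₗ[R] R) (l : L) (y : D ⊗[R] D) :
    TensorProduct.map ((TensorProduct.rid R L).toLinearMap ∘ₗ TensorProduct.map LinearMap.id e)
        (LinearMap.id : D →ₗ[R] D) ((TensorProduct.assoc R L D D).symm (l ⊗ₜ[R] y))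
      = l ⊗ₜ[R] TensorProduct.lid R D (e.rTensor D y) := by
  induction y with
  | zero => simp
  | tmul a b => simp [TensorProduct.smul_tmul]
  | add a b ha hb => simp only [TensorProduct.tmul_add, map_add, ha, hb]

/-- Contracting the middle factor of `id_L ⊗ Δ_D` with the counit gives the identity. -/
lemma map_rid_counit_assoc_symm_comul [Coalgebra R D] (x : L ⊗[R] D) :
    TensorProduct.map ((TensorProduct.rid R L).toLinearMap ∘ₗ
          TensorProduct.map LinearMap.id (Coalgebra.counit (R := R) (A := D)))
        (LinearMap.id : D →ₗ[R] D) ((TensorProduct.assoc R L D D).symm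
          (TensorProduct.map LinearMap.id (Coalgebra.comul (R := R)) x)) = x := by
  induction x with
  | zero => simp
  | tmul l d =>
    rw [TensorProduct.map_tmul, map_rid_assoc_symm_tmul, Coalgebra.rTensor_counit_comul]
    simp
  | add a b ha hb => simp only [map_add, ha, hb]

lemma map_rid_map_id_comp_comul [Coalgebra R D] (θ : D →ₗ[R] C) :
    ((TensorProduct.rid R C).toLinearMap ∘ₗ
        TensorProduct.map LinearMap.id (Coalgebra.counit (R := R) (A := D))) ∘ₗ
      (TensorProduct.map θ LinearMap.id ∘ₗ Coalgebra.comul (R := R)) = θ := by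
  ext d
  have h : ∀ y : D ⊗[R] D,
      TensorProduct.rid R C (TensorProduct.map LinearMap.id (Coalgebra.counit (R := R) (A := D))
          (TensorProduct.map θ LinearMap.id y))
        = θ (TensorProduct.rid R D ((Coalgebra.counit (R := R) (A := D)).lTensor D y)) := by
    intro y
    induction y with
    | zero => simp
    | tmul a b => simp
    | add a b ha hb => simp only [map_add, ha, hb]
  simp [h]

lemma comp_rid_map_id (ϱ : L →ₗ[R] L ⊗[R] C) (e : D →ₗ[R] R) (x : L ⊗[R] D) :
    ϱ (TensorProduct.rid R L (TensorProduct.map LinearMap.id e x))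
      = TensorProduct.map LinearMap.id
          ((TensorProduct.rid R C).toLinearMap ∘ₗ TensorProduct.map LinearMap.id e)
          (TensorProduct.assoc R L C D (TensorProduct.map ϱ LinearMap.id x)) := by
  induction x with
  | zero => simp
  | tmul l d =>
    simp only [TensorProduct.map_tmul, LinearMap.id_apply, TensorProduct.rid_tmul, map_smul]
    induction ϱ l with
    | zero => simp
    | tmul a c => simp
    | add a b ha hb => simp only [TensorProduct.add_tmul, smul_add, map_add, ha, hb]
  | add a b ha hb => simp only [map_add, ha, hb]

lemma mem_cotensor_iff (ϱL : L →ₗ[R] L ⊗[R] C) (ϱD : D →ₗ[R] C ⊗[R] D) (x : L ⊗[R] D) :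
    x ∈ cotensor R ϱL ϱD ↔
      TensorProduct.assoc R L C D (TensorProduct.map ϱL LinearMap.id x)
        = TensorProduct.map LinearMap.id ϱD x := by
  simp [cotensor, sub_eq_zero]

lemma phiMap_eq [Coalgebra R C] [Coalgebra R D] {θ : D →ₗ[R] C}
    (hθ : (Coalgebra.counit (R := R) (A := C)) ∘ₗ θ = Coalgebra.counit (R := R))
    (f : N →ₗ[R] L ⊗[R] D) :
    PhiMap θ f = ((TensorProduct.rid R L).toLinearMap ∘ₗ
      TensorProduct.map LinearMap.id (Coalgebra.counit (R := R) (A := D))) ∘ₗ f := by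
  rw [PhiMap, hθ, LinearMap.comp_assoc]

/-- A colinear map `f : N → L ⊗ D` is recovered from `PhiMap θ f`. -/
lemma map_phiMap_comp [Coalgebra R C] [Coalgebra R D] {θ : D →ₗ[R] C}
    (hθ : (Coalgebra.counit (R := R) (A := C)) ∘ₗ θ = Coalgebra.counit (R := R))
    {ϱN : N →ₗ[R] N ⊗[R] D} {f : N →ₗ[R] L ⊗[R] D}
    (hf : ((TensorProduct.assoc R L D D).symm.toLinearMap ∘ₗ
        (TensorProduct.map LinearMap.id (Coalgebra.comul (R := R)))) ∘ₗ f
      = (TensorProduct.map f LinearMap.id) ∘ₗ ϱN) :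
    (TensorProduct.map (PhiMap θ f) LinearMap.id) ∘ₗ ϱN = f := by
  rw [phiMap_eq hθ, ← LinearMap.id_comp (LinearMap.id : D →ₗ[R] D), TensorProduct.map_comp,
    LinearMap.comp_assoc, ← hf]
  ext n
  exact map_rid_counit_assoc_symm_comul (f n)

lemma assoc_map_map (g : N →ₗ[R] L) (θ : D →ₗ[R] C) (z : (N ⊗[R] D) ⊗[R] D) :
    TensorProduct.assoc R L C D (TensorProduct.map (TensorProduct.map g θ) LinearMap.id z)
      = TensorProduct.map g (TensorProduct.map θ LinearMap.id) (TensorProduct.assoc R N D D z) := by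
  rw [← TensorProduct.map_map_assoc]

end CounitContraction

/-- Let `C`, `D` be `R`-coalgebras with `D` flat, `θ : D → C` a coalgebra
morphism. With `D` a left `C`-comodule via `(θ ⊗ id) ∘ Δ_D` and `L □_C D` a right
`D`-comodule via `id_L □_C Δ_D`, the map `Φ : Hom^D(N, L □_C D) → Hom^C(N^θ, L)` is a
bijection natural in `N` and `L` with inverse `g ↦ (g □_C id_D) ∘ ϱ_N`: the corestriction
functor `(−)^θ` is left adjoint to `− □_C D`. -/
theorem corestriction_adjoint_cotensor
    {R C D L N : Type u} [CommRing R]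
    [AddCommGroup C] [Module R C] [Coalgebra R C]
    [AddCommGroup D] [Module R D] [Coalgebra R D] [Module.Flat R D]
    [AddCommGroup L] [Module R L] [AddCommGroup N] [Module R N]
    (θ : D →ₗ[R] C)
    (hθcomul : (Coalgebra.comul (R := R)) ∘ₗ θ
        = (TensorProduct.map θ θ) ∘ₗ (Coalgebra.comul (R := R)))
    (hθcounit : (Coalgebra.counit (R := R) (A := C)) ∘ₗ θ = Coalgebra.counit (R := R))
    -- `D` as a left `C`-comodule
    (ϱD : D →ₗ[R] C ⊗[R] D)
    (hϱD : ϱD = (TensorProduct.map θ LinearMap.id) ∘ₗ (Coalgebra.comul (R := R)))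
    -- `N` a counital right `D`-comodule, `L` a counital right `C`-comodule
    (ϱN : N →ₗ[R] N ⊗[R] D) (hN : IsRightComodule R ϱN) (hNinj : Function.Injective ϱN)
    (ϱL : L →ₗ[R] L ⊗[R] C) (hL : IsRightComodule R ϱL) (hLinj : Function.Injective ϱL) :
    -- `Φ` maps `D`-colinear maps `N → L □_C D` to `C`-colinear maps `N^θ → L`
    (∀ f : N →ₗ[R] L ⊗[R] D,
      (∀ n : N, f n ∈ cotensor R ϱL ϱD) →
      (((TensorProduct.assoc R L D D).symm.toLinearMap ∘ₗ
          (TensorProduct.map LinearMap.id (Coalgebra.comul (R := R)))) ∘ₗ f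
        = (TensorProduct.map f LinearMap.id) ∘ₗ ϱN) →
      ϱL ∘ₗ (PhiMap θ f)
        = (TensorProduct.map (PhiMap θ f) LinearMap.id) ∘ₗ
            ((TensorProduct.map LinearMap.id θ) ∘ₗ ϱN))
    ∧
    -- the inverse `Ψ : g ↦ (g □_C id_D) ∘ ϱ_N` lands in `Hom^D(N, L □_C D)` and `Φ∘Ψ = id`
    (∀ g : N →ₗ[R] L,
      (ϱL ∘ₗ g = (TensorProduct.map g LinearMap.id) ∘ₗ
          ((TensorProduct.map LinearMap.id θ) ∘ₗ ϱN)) →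
      (∀ n : N, ((TensorProduct.map g LinearMap.id) ∘ₗ ϱN) n ∈ cotensor R ϱL ϱD)
      ∧ (((TensorProduct.assoc R L D D).symm.toLinearMap ∘ₗ
            (TensorProduct.map LinearMap.id (Coalgebra.comul (R := R)))) ∘ₗ
              ((TensorProduct.map g LinearMap.id) ∘ₗ ϱN)
          = (TensorProduct.map ((TensorProduct.map g LinearMap.id) ∘ₗ ϱN) LinearMap.id)
              ∘ₗ ϱN)
      ∧ PhiMap θ ((TensorProduct.map g LinearMap.id) ∘ₗ ϱN) = g)
    ∧
    -- `Ψ ∘ Φ = id`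
    (∀ f : N →ₗ[R] L ⊗[R] D,
      (∀ n : N, f n ∈ cotensor R ϱL ϱD) →
      (((TensorProduct.assoc R L D D).symm.toLinearMap ∘ₗ
          (TensorProduct.map LinearMap.id (Coalgebra.comul (R := R)))) ∘ₗ f
        = (TensorProduct.map f LinearMap.id) ∘ₗ ϱN) →
      (TensorProduct.map (PhiMap θ f) LinearMap.id) ∘ₗ ϱN = f)
    ∧
    -- naturality in `N`
    (∀ (N' : Type u) [AddCommGroup N'] [Module R N'],
      ∀ (ϱN' : N' →ₗ[R] N' ⊗[R] D), IsRightComodule R ϱN' → Function.Injective ϱN' →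
      ∀ u : N' →ₗ[R] N,
        (ϱN ∘ₗ u = (TensorProduct.map u LinearMap.id) ∘ₗ ϱN') →
        ∀ f : N →ₗ[R] L ⊗[R] D, PhiMap θ (f ∘ₗ u) = (PhiMap θ f) ∘ₗ u)
    ∧
    -- naturality in `L`
    (∀ (L' : Type u) [AddCommGroup L'] [Module R L'],
      ∀ (ϱL' : L' →ₗ[R] L' ⊗[R] C), IsRightComodule R ϱL' → Function.Injective ϱL' →
      ∀ v : L →ₗ[R] L',
        (ϱL' ∘ₗ v = (TensorProduct.map v LinearMap.id) ∘ₗ ϱL) →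
        ∀ f : N →ₗ[R] L ⊗[R] D,
          PhiMap θ ((TensorProduct.map v LinearMap.id) ∘ₗ f) = v ∘ₗ (PhiMap θ f)) := by
  refine ⟨?_, ?_, fun f _ hf => map_phiMap_comp hθcounit hf, ?_, ?_⟩
  · intro f hfmem hf
    ext n
    have hrec : TensorProduct.map (PhiMap θ f) LinearMap.id (ϱN n) = f n :=
      LinearMap.congr_fun (map_phiMap_comp hθcounit hf) n
    have hleft : ϱL (PhiMap θ f n) = TensorProduct.map LinearMap.id θ (f n) := by
      rw [phiMap_eq hθcounit]
      change ϱL (TensorProduct.rid R L (TensorProduct.map LinearMap.id _ (f n))) = _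
      rw [comp_rid_map_id, (mem_cotensor_iff _ _ _).1 (hfmem n), ← LinearMap.comp_apply,
        ← TensorProduct.map_comp, hϱD, map_rid_map_id_comp_comul, LinearMap.id_comp]
    rw [LinearMap.comp_apply, hleft, ← hrec]
    simp only [LinearMap.comp_apply, TensorProduct.map_map, LinearMap.id_comp, LinearMap.comp_id]
  · intro g hg
    have hco : ∀ n, TensorProduct.assoc R N D D (TensorProduct.map ϱN LinearMap.id (ϱN n))
        = TensorProduct.map LinearMap.id (Coalgebra.comul (R := R)) (ϱN n) :=
      fun n => LinearMap.congr_fun hN.1 n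
    refine ⟨fun n => ?_, ?_, ?_⟩
    · have hg' : ϱL ∘ₗ g = TensorProduct.map g θ ∘ₗ ϱN := by
        rw [hg, ← LinearMap.comp_assoc, ← TensorProduct.map_comp, LinearMap.id_comp,
          LinearMap.comp_id]
      have hsplit : TensorProduct.map (ϱL ∘ₗ g) (LinearMap.id : D →ₗ[R] D) (ϱN n)
          = TensorProduct.map (TensorProduct.map g θ) LinearMap.id
              (TensorProduct.map ϱN LinearMap.id (ϱN n)) := by
        rw [hg', TensorProduct.map_map, LinearMap.id_comp]
      rw [mem_cotensor_iff, LinearMap.comp_apply, TensorProduct.map_map, LinearMap.id_comp, hsplit,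
        assoc_map_map, hco, TensorProduct.map_map, TensorProduct.map_map, hϱD]
      simp only [LinearMap.comp_id, LinearMap.id_comp]
    · ext n
      have hsplit : TensorProduct.map (TensorProduct.map g LinearMap.id ∘ₗ ϱN)
            (LinearMap.id : D →ₗ[R] D) (ϱN n)
          = TensorProduct.map (TensorProduct.map g LinearMap.id) LinearMap.id
              (TensorProduct.map ϱN LinearMap.id (ϱN n)) := by
        rw [TensorProduct.map_map, LinearMap.id_comp]
      simp only [LinearMap.comp_apply, LinearEquiv.coe_coe]
      rw [hsplit, LinearEquiv.symm_apply_eq, assoc_map_map, hco, TensorProduct.map_map,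
        TensorProduct.map_map, TensorProduct.map_id]
      simp only [LinearMap.comp_id, LinearMap.id_comp]
    · ext n
      rw [phiMap_eq hθcounit]
      have hnat : ∀ x : N ⊗[R] D,
          TensorProduct.rid R L (TensorProduct.map LinearMap.id (Coalgebra.counit (R := R))
            (TensorProduct.map g LinearMap.id x))
          = g (TensorProduct.rid R N
              (TensorProduct.map LinearMap.id (Coalgebra.counit (R := R)) x)) := by
        intro x
        induction x with
        | zero => simp
        | tmul a b => simp
        | add a b ha hb => simp only [map_add, ha, hb]
      exact (hnat (ϱN n)).trans (congrArg g (hN.2 n))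
  · intro N' _ _ ϱN' _ _ u _ f
    rfl
  · intro L' _ _ ϱL' _ _ v _ f
    ext n
    simp only [PhiMap, LinearMap.comp_apply, LinearEquiv.coe_coe]
    induction f n with
    | zero => simp
    | tmul a b => simp
    | add a b ha hb => simp only [map_add, ha, hb]
end
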